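/- Let T > 0, α > 0, γ ∈ ℝ, and let f : (ℝ/Tℤ) × (ℝ/2πℤ) × ℝ → ℝ be C¹ and satisfy f(t, −π/2, 0) < α and f(t, π/2, 0) > −α for all t ∈ [0, T]. Then the forced relativistic pendulum with viscous friction, d/dt ( φ̇ / √(1 − φ̇²) ) = f(t, φ, φ̇) − γ φ̇ + α sin φ, has at least one T-periodic solution φ, and this solution satisfies −π/2 < φ(t) < π/2 for all t. -/

import Mathlib

section

open Set Filter Topology

section PeriodicOrbit

variable {E : Type*} [NormedAddCommGroup E] {X : ℝ → E → E} {T L M : ℝ}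

theorem lipschitzOnWith_of_joint (hL0 : 0 ≤ L) {S : Set ℝ}
    (hL : ∀ t ∈ S, ∀ s ∈ S, ∀ x y, ‖X t x - X s y‖ ≤ L * (|t - s| + ‖x - y‖)) {t : ℝ}
    (ht : t ∈ S) (s : Set E) : LipschitzOnWith L.toNNReal (X t) s := by
  refine LipschitzOnWith.of_dist_le_mul fun x _ y _ => ?_
  rw [dist_eq_norm, dist_eq_norm, Real.coe_toNNReal _ hL0]
  simpa using hL t ht t ht x y

variable [NormedSpace ℝ E]

theorem exists_solution_on_Icc [CompleteSpace E] {a b : ℝ} (ha : a ≤ 0) (hb : 0 ≤ b)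
    (hL0 : 0 ≤ L) (hM0 : 0 ≤ M)
    (hL : ∀ t ∈ Icc a b, ∀ s ∈ Icc a b, ∀ x y,
      ‖X t x - X s y‖ ≤ L * (|t - s| + ‖x - y‖))
    (hM : ∀ t ∈ Icc a b, ∀ x, ‖X t x‖ ≤ M) (x₀ : E) :
    ∃ Z : ℝ → E, Z 0 = x₀ ∧
      ∀ t ∈ Icc a b, HasDerivWithinAt Z (X t (Z t)) (Icc a b) t := by
  have hmax : 0 ≤ max b (-a) := le_max_of_le_left hb
  have hpl : IsPicardLindelof X (tmin := a) (tmax := b) ⟨0, ha, hb⟩ x₀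
      (M * max b (-a)).toNNReal 0 M.toNNReal L.toNNReal :=
    { lipschitzOnWith := fun t ht => lipschitzOnWith_of_joint hL0 hL ht _
      continuousOn := fun x _ => by
        have : LipschitzOnWith L.toNNReal (X · x) (Icc a b) := by
          refine LipschitzOnWith.of_dist_le_mul fun t ht s hs => ?_
          rw [dist_eq_norm, Real.dist_eq, Real.coe_toNNReal _ hL0]
          simpa using hL t ht s hs x x
        exact this.continuousOn
      norm_le := fun t ht x _ => by
        rw [Real.coe_toNNReal _ hM0]
        exact hM t ht x
      mul_max_le := by
        rw [Real.coe_toNNReal _ hM0, Real.coe_toNNReal _ (mul_nonneg hM0 hmax)]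
        simp }
  exact hpl.exists_eq_forall_mem_Icc_hasDerivWithinAt₀

theorem norm_euler_residual_le {a b : ℝ} (hL0 : 0 ≤ L) (hM0 : 0 ≤ M)
    (hL : ∀ t ∈ Icc a b, ∀ s ∈ Icc a b, ∀ x y,
      ‖X t x - X s y‖ ≤ L * (|t - s| + ‖x - y‖))
    (hM : ∀ t ∈ Icc a b, ∀ x, ‖X t x‖ ≤ M) {Z : ℝ → E}
    (hZ : ∀ t ∈ Icc a b, HasDerivWithinAt Z (X t (Z t)) (Icc a b) t)
    {t h : ℝ} (hh : 0 ≤ h) (ht : a ≤ t) (hth : t + h ≤ b) :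
    ‖Z (t + h) - Z t - h • X t (Z t)‖ ≤ L * (1 + M) * h ^ 2 := by
  have hsub : Icc t (t + h) ⊆ Icc a b := Icc_subset_Icc ht hth
  have htm : t ∈ Icc t (t + h) := ⟨le_rfl, by linarith⟩
  have hthm : t + h ∈ Icc t (t + h) := ⟨by linarith, le_rfl⟩
  have hlip : ∀ s ∈ Icc t (t + h), ‖Z s - Z t‖ ≤ M * h := by
    intro s hs
    have := (convex_Icc a b).norm_image_sub_le_of_norm_hasDerivWithin_le hZ
      (fun x hx => hM x hx _) (hsub htm) (hsub hs)
    refine this.trans (mul_le_mul_of_nonneg_left ?_ hM0)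
    rw [Real.norm_eq_abs, abs_le]
    constructor <;> linarith [hs.1, hs.2]
  have hder : ∀ s ∈ Icc t (t + h), HasDerivWithinAt (fun s => Z s - s • X t (Z t))
      (X s (Z s) - X t (Z t)) (Icc t (t + h)) s := by
    intro s hs
    have h1 := (hZ s (hsub hs)).mono hsub
    have h2 := ((hasDerivAt_id s).smul_const (X t (Z t))).hasDerivWithinAt (s := Icc t (t + h))
    rw [one_smul] at h2
    exact h1.sub h2
  have hbd : ∀ s ∈ Icc t (t + h), ‖X s (Z s) - X t (Z t)‖ ≤ L * (1 + M) * h := by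
    intro s hs
    have h1 := hL s (hsub hs) t (hsub htm) (Z s) (Z t)
    have h2 : |s - t| ≤ h := by
      rw [abs_le]
      constructor <;> linarith [hs.1, hs.2]
    calc _ ≤ L * (|s - t| + ‖Z s - Z t‖) := h1
      _ ≤ L * (h + M * h) := by gcongr; exact hlip s hs
      _ = _ := by ring
  have := (convex_Icc t (t + h)).norm_image_sub_le_of_norm_hasDerivWithin_le hder hbd htm hthm
  have heq : Z (t + h) - Z t - h • X t (Z t)
      = Z (t + h) - (t + h) • X t (Z t) - (Z t - t • X t (Z t)) := by
    rw [add_smul]; abel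
  rw [heq]
  refine this.trans (le_of_eq ?_)
  rw [Real.norm_eq_abs, add_sub_cancel_left, abs_of_nonneg hh]
  ring

theorem exists_periodic_solution_of_eq (hT : 0 < T) (hL0 : 0 ≤ L)
    (hper : ∀ t x, X (t + T) x = X t x)
    (hL : ∀ t ∈ Icc (-T) (2 * T), ∀ s ∈ Icc (-T) (2 * T), ∀ x y,
      ‖X t x - X s y‖ ≤ L * (|t - s| + ‖x - y‖)) {Z : ℝ → E}
    (hZ : ∀ t ∈ Icc (-T) (2 * T), HasDerivWithinAt Z (X t (Z t)) (Icc (-T) (2 * T)) t)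
    (hZT : Z T = Z 0) :
    ∃ W : ℝ → E, (∀ t, W (t + T) = W t) ∧ ∀ t, HasDerivAt W (X t (W t)) t := by
  have hZ' : ∀ t ∈ Ioo (-T) (2 * T), HasDerivAt Z (X t (Z t)) t := fun t ht =>
    (hZ t (Ioo_subset_Icc_self ht)).hasDerivAt (Icc_mem_nhds ht.1 ht.2)
  have hshift : EqOn (fun t => Z (t + T)) Z (Ioo (-T) T) := by
    refine ODE_solution_unique_of_mem_Ioo (v := X) (s := fun _ => univ) (K := L.toNNReal)
      (t₀ := 0) (fun t ht => ?_) ⟨by linarith, hT⟩ (fun t ht => ⟨?_, trivial⟩)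
      (fun t ht => ⟨?_, trivial⟩) (by simpa using hZT)
    · exact lipschitzOnWith_of_joint hL0 hL ⟨ht.1.le, by linarith [ht.2]⟩ _
    · rw [← hper t]
      exact (hZ' (t + T) ⟨by linarith [ht.1], by linarith [ht.2]⟩).comp_add_const t T
    · exact hZ' t ⟨ht.1, by linarith [ht.2]⟩
  have hperz : ∀ t x (n : ℤ), X (t + n * T) x = X t x := by
    intro t x n
    have : Function.Periodic (fun t => X t x) T := fun t => hper t x
    exact this.int_mul n t
  set W : ℝ → E := fun t => Z (toIcoMod hT 0 t) with hW
  have hWper : ∀ t, W (t + T) = W t := fun t => by simp [hW]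
  have hWperz : ∀ t (n : ℤ), W (t + n * T) = W t := fun t n =>
    Function.Periodic.int_mul (f := W) hWper n t
  have hWZ : ∀ t ∈ Ioo (-T) T, W t = Z t := by
    intro t ht
    rcases lt_or_ge t 0 with h | h
    · rw [← hshift ht, ← hWper t]
      simp only [hW]
      rw [(toIcoMod_eq_self hT).2 ⟨by linarith [ht.1], by linarith⟩]
    · simp only [hW]
      rw [(toIcoMod_eq_self hT).2 ⟨h, by linarith [ht.2]⟩]
  refine ⟨W, hWper, fun t => ?_⟩
  set s := toIcoMod hT 0 t
  set n := toIcoDiv hT 0 t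
  have hs : s ∈ Ico 0 (0 + T) := toIcoMod_mem_Ico hT 0 t
  have hsn : t = s + n * T := by
    have := toIcoMod_add_toIcoDiv_zsmul hT 0 t
    rw [zsmul_eq_mul] at this
    exact this.symm
  have hds : HasDerivAt W (X s (W s)) s := by
    have hmem : s ∈ Ioo (-T) T := ⟨by linarith [hs.1], by linarith [hs.2]⟩
    have hev : W =ᶠ[𝓝 s] Z := by
      filter_upwards [Ioo_mem_nhds hmem.1 hmem.2] with r hr using hWZ r hr
    rw [hWZ s hmem]
    exact (hZ' s ⟨hmem.1, by linarith [hmem.2]⟩).congr_of_eventuallyEq hev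
  have hfun : W = fun r => W (r - n * T) := by
    funext r
    have := hWperz (r - n * T) n
    rwa [sub_add_cancel] at this
  rw [hsn, hperz, hWperz, hfun]
  have : s = s + n * T - n * T := by ring
  have key : HasDerivAt W (X s (W s)) (s + n * T - n * T) := by rwa [← this]
  have := key.comp_sub_const (s + n * T) (n * T)
  convert this using 2
  exact (congrFun hfun s).symm

theorem le_mul_pow_of_succ_le {e : ℕ → ℝ} {c b : ℝ} {N : ℕ} (hc : 0 ≤ c) (hb : 0 ≤ b)
    (he : ∀ i < N, e (i + 1) ≤ (1 + c) * e i + b) :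
    ∀ i ≤ N, e i ≤ (e 0 + i * b) * (1 + c) ^ i := by
  intro i
  induction i with
  | zero => simp
  | succ k ih =>
    intro hk
    have h1 := he k (by omega)
    have h2 := mul_le_mul_of_nonneg_left (ih (by omega)) (by linarith : 0 ≤ 1 + c)
    have h3 : b ≤ b * (1 + c) ^ (k + 1) :=
      le_mul_of_one_le_right hb (one_le_pow₀ (by linarith))
    push_cast
    calc e (k + 1) ≤ (1 + c) * ((e 0 + k * b) * (1 + c) ^ k) + b * (1 + c) ^ (k + 1) := by
          linarith
      _ = _ := by ring

theorem exists_periodic_solution_of_discrete [FiniteDimensional ℝ E] (hT : 0 < T) (hL0 : 0 ≤ L)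
    (hM0 : 0 ≤ M) (hper : ∀ t x, X (t + T) x = X t x)
    (hL : ∀ t ∈ Icc (-T) (2 * T), ∀ s ∈ Icc (-T) (2 * T), ∀ x y,
      ‖X t x - X s y‖ ≤ L * (|t - s| + ‖x - y‖))
    (hM : ∀ t ∈ Icc (-T) (2 * T), ∀ x, ‖X t x‖ ≤ M) {C R : ℝ} (hC : 0 ≤ C)
    (hz : ∀ᶠ N : ℕ in atTop, ∃ z : ℕ → E, z N = z 0 ∧ ‖z 0‖ ≤ R ∧ ∀ i < N,
      ‖z (i + 1) - z i - (T / N) • X (i * (T / N)) (z i)‖ ≤ C * (T / N) ^ 2) :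
    ∃ W : ℝ → E, (∀ t, W (t + T) = W t) ∧ ∀ t, HasDerivAt W (X t (W t)) t := by
  have : CompleteSpace E := FiniteDimensional.complete ℝ E
  have : ProperSpace E := FiniteDimensional.proper ℝ E
  obtain ⟨N₀, hN₀⟩ := eventually_atTop.1 hz
  choose! z hzN hz0 hzs using hN₀
  obtain ⟨p, -, φ, hφ, hlim⟩ := (isCompact_closedBall (0 : E) R).tendsto_subseq
    (x := fun k => z (k + (N₀ + 1)) 0) (fun k => by
      simpa using hz0 (k + (N₀ + 1)) (by omega))
  obtain ⟨Z, hZ0, hZ⟩ := exists_solution_on_Icc (a := -T) (b := 2 * T) (by linarith)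
    (by linarith) hL0 hM0 hL hM p
  refine exists_periodic_solution_of_eq hT hL0 hper hL hZ ?_
  set D := C + L * (1 + M) with hD
  have hD0 : 0 ≤ D := by positivity
  have hbound : ∀ N, N₀ + 1 ≤ N →
      ‖z N 0 - Z T‖ ≤ (‖z N 0 - p‖ + T * D * (T / N)) * Real.exp (L * T) := by
    intro N hN
    have hNpos : (0 : ℝ) < N := by exact_mod_cast (by omega : 0 < N)
    set h := T / N with hh
    have hhpos : 0 < h := by positivity
    have hNh : N * h = T := by rw [hh]; field_simp
    have step := le_mul_pow_of_succ_le (e := fun i => ‖z N i - Z (i * h)‖) (c := L * h) (b := D * h ^ 2)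
      (N := N) (by positivity) (by positivity) (fun i hi => by
        have hi0 : 0 ≤ i * h := by positivity
        have hi1 : i * h + h ≤ T := by
          have : ((i + 1 : ℕ) : ℝ) ≤ N := by exact_mod_cast hi
          push_cast at this
          nlinarith
        have hmem : i * h ∈ Icc (-T) (2 * T) := ⟨by linarith, by linarith⟩
        have h1 := hzs N (by omega) i hi
        have h2 := norm_euler_residual_le hL0 hM0 hL hM hZ hhpos.le
          (t := i * h) (by linarith) (by linarith)
        have h3 := hL _ hmem _ hmem (z N i) (Z (i * h))
        simp only [sub_self, abs_zero, zero_add] at h3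
        have hcast : ((i + 1 : ℕ) : ℝ) * h = i * h + h := by push_cast; ring
        rw [hcast]
        have heq : z N (i + 1) - Z (i * h + h) = (z N i - Z (i * h))
            + h • (X (i * h) (z N i) - X (i * h) (Z (i * h)))
            + (z N (i + 1) - z N i - h • X (i * h) (z N i))
            - (Z (i * h + h) - Z (i * h) - h • X (i * h) (Z (i * h))) := by
          rw [smul_sub]; abel
        have h4 : ‖h • (X (i * h) (z N i) - X (i * h) (Z (i * h)))‖
            ≤ h * (L * ‖z N i - Z (i * h)‖) := by
          rw [norm_smul, Real.norm_eq_abs, abs_of_pos hhpos]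
          gcongr
        rw [heq]
        have h5 := norm_add₃_le (a := z N i - Z (i * h))
          (b := h • (X (i * h) (z N i) - X (i * h) (Z (i * h))))
          (c := z N (i + 1) - z N i - h • X (i * h) (z N i))
        refine (norm_sub_le _ _).trans ?_
        rw [hD]
        nlinarith)
    have hN' := step N le_rfl
    simp only [Nat.cast_zero, zero_mul] at hN'
    rw [hzN N (by omega), hNh, hZ0] at hN'
    refine hN'.trans ?_
    have hexp : (1 + L * h) ^ N ≤ Real.exp (L * T) := by
      have h1 : 1 + L * h ≤ Real.exp (L * h) := by
        linarith [Real.add_one_le_exp (L * h)]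
      calc (1 + L * h) ^ N ≤ Real.exp (L * h) ^ N := by gcongr
        _ = Real.exp (L * T) := by rw [← Real.exp_nat_mul, ← hNh]; ring_nf
    have : (N : ℝ) * (D * h ^ 2) = T * D * h := by rw [← hNh]; ring
    rw [this]
    gcongr
  have hto : Tendsto (fun k : ℕ => φ k + (N₀ + 1)) atTop atTop :=
    (tendsto_add_atTop_nat _).comp hφ.tendsto_atTop
  have hh0 : Tendsto (fun k : ℕ => T / ((φ k + (N₀ + 1) : ℕ) : ℝ)) atTop (𝓝 0) :=
    (tendsto_const_div_atTop_nhds_zero_nat T).comp hto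
  have hl1 : Tendsto (fun k => ‖z (φ k + (N₀ + 1)) 0 - Z T‖) atTop (𝓝 ‖p - Z T‖) :=
    (hlim.sub_const _).norm
  have hl2 : Tendsto (fun k => (‖z (φ k + (N₀ + 1)) 0 - p‖
      + T * D * (T / ((φ k + (N₀ + 1) : ℕ) : ℝ))) * Real.exp (L * T)) atTop
      (𝓝 ((‖p - p‖ + T * D * 0) * Real.exp (L * T))) :=
    (((hlim.sub_const p).norm).add (hh0.const_mul _)).mul_const _
  have := le_of_tendsto_of_tendsto' hl1 hl2 (fun k => hbound _ (by omega))
  simp only [sub_self, norm_zero, mul_zero, add_zero, zero_mul] at this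
  have := norm_le_zero_iff.1 this
  rw [hZ0]
  exact (sub_eq_zero.1 this).symm

end PeriodicOrbit

section DiscretePerron

variable {ι : Type*} (σ : Equiv.Perm ι) {Ψ : ℝ → ℝ}
  {G : ι → ℝ → ℝ → ℝ} {a : ℝ}

/-- Residual of the implicit scheme along the cycle(s) of `σ`. -/
def schemeResidual (Ψ : ℝ → ℝ) (G : ι → ℝ → ℝ → ℝ) (u : ι → ℝ) (i : ι) : ℝ :=
  Ψ (u (σ i) - u i) - Ψ (u i - u (σ.symm i)) - G i (u i) (Ψ (u (σ i) - u i))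

theorem continuous_schemeResidual (hΨ : Continuous Ψ)
    (hG : ∀ i, Continuous fun p : ℝ × ℝ => G i p.1 p.2) (i : ι) :
    Continuous fun u => schemeResidual σ Ψ G u i := by
  have h1 : Continuous fun u : ι → ℝ => Ψ (u (σ i) - u i) := by fun_prop
  have h2 : Continuous fun u : ι → ℝ => Ψ (u i - u (σ.symm i)) := by fun_prop
  exact (h1.sub h2).sub ((hG i).comp ((continuous_apply i).prodMk h1))

theorem exists_increment_sign_change [Finite ι] [Nonempty ι] (hmono : Monotone Ψ) (hΨ0 : Ψ 0 = 0)
    (u : ι → ℝ) : ∃ i, Ψ (u (σ i) - u i) ≤ 0 ∧ 0 ≤ Ψ (u i - u (σ.symm i)) := by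
  obtain ⟨i, hi⟩ := Finite.exists_max u
  refine ⟨i, ?_, ?_⟩
  · rw [← hΨ0]; exact hmono (by linarith [hi (σ i)])
  · rw [← hΨ0]; exact hmono (by linarith [hi (σ.symm i)])

theorem exists_schemeResidual_eq_zero [Fintype ι] [DecidableEq ι] (hΨ : Continuous Ψ)
    (hmono : Monotone Ψ) (hΨ0 : Ψ 0 = 0)
    (hG : ∀ i, Continuous fun p : ℝ × ℝ => G i p.1 p.2)
    (hGmono : ∀ i u, Monotone fun v => v - G i u v) (ha : 0 ≤ a)
    (hlow : ∀ i, G i (-a) 0 ≤ 0) (hhigh : ∀ i, 0 < G i a 0) :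
    ∃ u : ι → ℝ, (∀ i, |u i| ≤ a) ∧ ∀ i, schemeResidual σ Ψ G u i = 0 := by
  set S : Set (ι → ℝ) := (univ.pi fun _ => Icc (-a) a) ∩
    {u | ∀ i, 0 ≤ schemeResidual σ Ψ G u i} with hS
  have hScomp : IsCompact S := by
    refine (isCompact_univ_pi fun _ => isCompact_Icc).inter_right ?_
    rw [Set.ofPred_forall]
    exact isClosed_iInter fun i =>
      isClosed_le continuous_const (continuous_schemeResidual σ hΨ hG i)
  have hSne : S.Nonempty := by
    refine ⟨fun _ => -a, fun i _ => ⟨le_rfl, by linarith⟩, fun i => ?_⟩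
    simpa [schemeResidual, hΨ0] using hlow i
  obtain ⟨u, huS, humax⟩ := hScomp.exists_isMaxOn hSne
    (f := fun u => ∑ i, u i) (by fun_prop)
  have hmem : ∀ i, u i ∈ Icc (-a) a := fun i => huS.1 i trivial
  refine ⟨u, fun i => abs_le.2 (hmem i), fun i => ?_⟩
  by_contra hne
  have hpos : 0 < schemeResidual σ Ψ G u i := lt_of_le_of_ne (huS.2 i) (Ne.symm hne)
  have hlt : u i < a := by
    refine lt_of_le_of_ne (hmem i).2 fun heq => ?_
    have h1 : Ψ (u (σ i) - u i) ≤ 0 := by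
      rw [← hΨ0]
      exact hmono (by linarith [(hmem (σ i)).2])
    have h2 : 0 ≤ Ψ (u i - u (σ.symm i)) := by
      rw [← hΨ0]
      exact hmono (by linarith [(hmem (σ.symm i)).2])
    have h3 := hGmono i (u i) h1
    simp only [schemeResidual] at hpos
    have h4 := hhigh i
    rw [← heq] at h4
    simp only at h3
    linarith
  have hcont : Continuous fun x : ℝ => schemeResidual σ Ψ G (Function.update u i x) i :=
    (continuous_schemeResidual σ hΨ hG i).comp (continuous_const.update i continuous_id)
  have hev : ∀ᶠ x in 𝓝 (u i), 0 < schemeResidual σ Ψ G (Function.update u i x) i :=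
    hcont.continuousAt.eventually_const_lt (by simpa using hpos)
  obtain ⟨x, ⟨hx1, hx2⟩, hx3⟩ :=
    ((hev.filter_mono nhdsWithin_le_nhds).and (Ioo_mem_nhdsGT hlt)).exists.imp
      fun x hx => (⟨⟨hx.1, hx.2.1⟩, hx.2.2⟩ : (_ ∧ u i < x) ∧ x < a)
  set w := Function.update u i x with hw
  have hwi : w i = x := by simp [hw]
  have hwj : ∀ j, j ≠ i → w j = u j := fun j hj => by simp [hw, hj]
  have hge : ∀ j, u j ≤ w j := fun j => by
    rcases eq_or_ne j i with rfl | hj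
    · rw [hwi]; exact hx2.le
    · rw [hwj j hj]
  have hwS : w ∈ S := by
    refine ⟨fun j _ => ?_, fun j => ?_⟩
    · rcases eq_or_ne j i with rfl | hj
      · rw [hwi]
        exact ⟨by linarith [(hmem j).1], hx3.le⟩
      · rw [hwj j hj]; exact hmem j
    · rcases eq_or_ne j i with rfl | hj
      · exact hx1.le
      · refine (huS.2 j).trans ?_
        have h1 : Ψ (u (σ j) - u j) ≤ Ψ (w (σ j) - w j) :=
          hmono (by rw [hwj j hj]; linarith [hge (σ j)])
        have h2 : Ψ (w j - w (σ.symm j)) ≤ Ψ (u j - u (σ.symm j)) :=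
          hmono (by rw [hwj j hj]; linarith [hge (σ.symm j)])
        have h3 := hGmono j (u j) h1
        simp only [schemeResidual, hwj j hj] at h3 h1 h2 ⊢
        linarith
  have hsum : ∑ j, u j < ∑ j, w j :=
    Finset.sum_lt_sum (fun j _ => hge j) ⟨i, Finset.mem_univ i, by rw [hwi]; exact hx2⟩
  exact absurd (humax hwS) (not_le.2 hsum)

end DiscretePerron

section TruncatedInverse

/-- The map `p ↦ p / √(1 - p²) = tan (arcsin p)`, made constant where its modulus exceeds
`tan b`. -/
noncomputable def truncTanArcsin (b p : ℝ) : ℝ :=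
  Real.tan (max (-b) (min b (Real.arcsin p)))

variable {b : ℝ}

theorem truncation_mem_Ioo (hb0 : 0 ≤ b) (hb : b < Real.pi / 2) (x : ℝ) :
    max (-b) (min b x) ∈ Ioo (-(Real.pi / 2)) (Real.pi / 2) :=
  ⟨lt_of_lt_of_le (by linarith) (le_max_left _ _),
    max_lt (by linarith) (lt_of_le_of_lt (min_le_left _ _) hb)⟩

theorem continuous_truncTanArcsin (hb0 : 0 ≤ b) (hb : b < Real.pi / 2) :
    Continuous (truncTanArcsin b) := by
  refine Real.continuousOn_tan_Ioo.comp_continuous ?_ fun p => truncation_mem_Ioo hb0 hb _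
  exact continuous_const.max (continuous_const.min Real.continuous_arcsin)

theorem monotone_truncTanArcsin (hb0 : 0 ≤ b) (hb : b < Real.pi / 2) :
    Monotone (truncTanArcsin b) := by
  intro p q hpq
  refine Real.strictMonoOn_tan.monotoneOn (truncation_mem_Ioo hb0 hb _)
    (truncation_mem_Ioo hb0 hb _) ?_
  exact max_le_max le_rfl (min_le_min le_rfl (Real.monotone_arcsin hpq))

theorem truncTanArcsin_zero (hb0 : 0 ≤ b) : truncTanArcsin b 0 = 0 := by
  simp [truncTanArcsin, hb0]

theorem sin_arctan_truncTanArcsin {B p : ℝ} (hB : 0 ≤ B)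
    (hp : |truncTanArcsin (Real.arctan (B + 1)) p| ≤ B) :
    Real.sin (Real.arctan (truncTanArcsin (Real.arctan (B + 1)) p)) = p := by
  set b := Real.arctan (B + 1) with hb
  have hb0 : 0 ≤ b := Real.arctan_nonneg.2 (by linarith)
  have hb2 : b < Real.pi / 2 := Real.arctan_lt_pi_div_two _
  have hm := truncation_mem_Ioo hb0 hb2 (Real.arcsin p)
  have hat : Real.arctan (truncTanArcsin b p) = max (-b) (min b (Real.arcsin p)) :=
    Real.arctan_tan hm.1 hm.2
  obtain ⟨h1, h2⟩ := abs_le.1 hp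
  have h3 : Real.arctan (truncTanArcsin b p) < b := Real.arctan_strictMono (by linarith)
  have h4 : -b < Real.arctan (truncTanArcsin b p) := by
    rw [hb, ← Real.arctan_neg]
    exact Real.arctan_strictMono (by linarith)
  rw [hat] at h3 h4
  have h5 : max (-b) (min b (Real.arcsin p)) = Real.arcsin p := by
    grind
  rw [hat, h5]
  rw [h5] at hm
  exact Real.sin_arcsin (Real.neg_pi_div_two_lt_arcsin.1 hm.1).le
    (Real.arcsin_lt_pi_div_two.1 hm.2).le

end TruncatedInverse

section Scheme

variable {F : ℝ → ℝ → ℝ → ℝ} {T L M a : ℝ}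

/-- The first-order system equivalent to `d/dt (u' / √(1 - u'²)) = F t u v` with
`v = u' / √(1 - u'²)`. -/
noncomputable def phaseField (F : ℝ → ℝ → ℝ → ℝ) (t : ℝ) (z : ℝ × ℝ) : ℝ × ℝ :=
  (Real.sin (Real.arctan z.2), F t z.1 z.2)

theorem exists_discrete_periodic_orbit (hT : 0 < T) (hL0 : 0 ≤ L) (hM0 : 0 ≤ M) (ha : 0 ≤ a)
    (hper : ∀ t u v, F (t + T) u v = F t u v)
    (hL : ∀ t ∈ Icc (-T) (2 * T), ∀ s ∈ Icc (-T) (2 * T), ∀ x y,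
      ‖phaseField F t x - phaseField F s y‖ ≤ L * (|t - s| + ‖x - y‖))
    (hM : ∀ t ∈ Icc (-T) (2 * T), ∀ x, ‖phaseField F t x‖ ≤ M)
    (hlow : ∀ t ∈ Icc 0 T, F t (-a) 0 ≤ 0) (hhigh : ∀ t ∈ Icc 0 T, 0 < F t a 0)
    {N : ℕ} [NeZero N] (hN : T / N * L ≤ 1) :
    ∃ z : ℕ → ℝ × ℝ, z N = z 0 ∧ ‖z 0‖ ≤ max a (T * M) ∧ ∀ i < N,
      ‖z (i + 1) - z i - (T / N) • phaseField F (i * (T / N)) (z i)‖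
        ≤ L * (1 + M) * (T / N) ^ 2 := by
  have hNpos : (0 : ℝ) < N := by exact_mod_cast Nat.pos_of_ne_zero (NeZero.ne N)
  set h := T / N with hh
  have hhpos : 0 < h := by positivity
  have hNh : N * h = T := by rw [hh]; field_simp
  have htime : ∀ k : ℕ, k ≤ N → (k : ℝ) * h ∈ Icc 0 T := fun k hk => by
    refine ⟨by positivity, ?_⟩
    rw [← hNh]
    gcongr
  have hsub : Icc 0 T ⊆ Icc (-T) (2 * T) := Icc_subset_Icc (by linarith) (by linarith)
  have hFL : ∀ t ∈ Icc 0 T, ∀ s ∈ Icc 0 T, ∀ x y : ℝ × ℝ,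
      |F t x.1 x.2 - F s y.1 y.2| ≤ L * (|t - s| + ‖x - y‖) := fun t ht s hs x y =>
    (norm_snd_le _).trans (hL t (hsub ht) s (hsub hs) x y)
  have hFM : ∀ t ∈ Icc 0 T, ∀ u v, |F t u v| ≤ M := fun t ht u v =>
    (norm_snd_le _).trans (hM t (hsub ht) (u, v))
  have hχM : ∀ v, |Real.sin (Real.arctan v)| ≤ M := fun v =>
    (norm_fst_le _).trans (hM 0 ⟨by linarith, by linarith⟩ (0, v))
  set B := T * M with hB
  have hB0 : 0 ≤ B := by positivity
  set b := Real.arctan (B + 1) with hb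
  have hb0 : 0 ≤ b := Real.arctan_nonneg.2 (by linarith)
  have hb2 : b < Real.pi / 2 := Real.arctan_lt_pi_div_two _
  set Ψ : ℝ → ℝ := fun d => truncTanArcsin b (d / h) with hΨ
  have hΨc : Continuous Ψ := (continuous_truncTanArcsin hb0 hb2).comp (by fun_prop)
  have hΨm : Monotone Ψ := fun p q hpq => monotone_truncTanArcsin hb0 hb2 (by gcongr)
  have hΨ0 : Ψ 0 = 0 := by simp [hΨ, truncTanArcsin_zero hb0]
  set σ : Equiv.Perm (ZMod N) := Equiv.addRight 1 with hσ
  have hσa : ∀ i, σ i = i + 1 := fun i => rfl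
  have hσs : ∀ i, σ.symm (i + 1) = i := fun i => by simp [hσ]
  set τ : ZMod N → ℝ := fun i => i.val * h with hτ
  have hτm : ∀ i, τ i ∈ Icc 0 T := fun i => htime _ (ZMod.val_lt i).le
  set G : ZMod N → ℝ → ℝ → ℝ := fun i u v => h * F (τ i) u v with hG
  have hGc : ∀ i, Continuous fun p : ℝ × ℝ => G i p.1 p.2 := by
    intro i
    have : LipschitzWith L.toNNReal fun p : ℝ × ℝ => F (τ i) p.1 p.2 := by
      refine LipschitzWith.of_dist_le_mul fun x y => ?_
      rw [Real.dist_eq, dist_eq_norm, Real.coe_toNNReal _ hL0]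
      simpa using hFL _ (hτm i) _ (hτm i) x y
    exact continuous_const.mul this.continuous
  have hGm : ∀ i u, Monotone fun v => v - G i u v := by
    intro i u v w hvw
    have h1 := hFL _ (hτm i) _ (hτm i) (u, w) (u, v)
    have h2 : ‖((u, w) : ℝ × ℝ) - (u, v)‖ = w - v := by
      simp [Prod.norm_def, abs_of_nonneg (sub_nonneg.2 hvw), hvw]
    rw [h2, sub_self, abs_zero, zero_add] at h1
    have h3 := (le_abs_self _).trans h1
    simp only at h3
    have h4 : h * (F (τ i) u w - F (τ i) u v) ≤ h * (L * (w - v)) := by gcongr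
    have h5 : h * L * (w - v) ≤ 1 * (w - v) := by
      gcongr
    simp only [hG]
    linarith
  obtain ⟨u, hua, hu⟩ := exists_schemeResidual_eq_zero σ (Ψ := Ψ) (G := G) hΨc hΨm hΨ0 hGc hGm ha
    (fun i => mul_nonpos_of_nonneg_of_nonpos hhpos.le (hlow _ (hτm i)))
    (fun i => mul_pos hhpos (hhigh _ (hτm i)))
  set v : ZMod N → ℝ := fun i => Ψ (u (i + 1) - u i) with hv
  have hstep : ∀ i, v (i + 1) = v i + h * F (τ (i + 1)) (u (i + 1)) (v (i + 1)) := by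
    intro i
    have := hu (i + 1)
    simp only [schemeResidual, hσa, hσs] at this
    simp only [hv, hG] at this ⊢
    linarith
  have hstepM : ∀ i, |v (i + 1) - v i| ≤ h * M := by
    intro i
    rw [hstep i, add_sub_cancel_left, abs_mul, abs_of_pos hhpos]
    gcongr
    exact hFM _ (hτm _) _ _
  have hvB : ∀ i, |v i| ≤ B := by
    obtain ⟨i₀, hi1, hi2⟩ := exists_increment_sign_change σ hΨm hΨ0 u
    obtain ⟨j, rfl⟩ : ∃ j, i₀ = j + 1 := ⟨i₀ - 1, by simp⟩
    rw [hσs] at hi2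
    have key : ∀ k : ℕ, |v (j + 1 + k)| ≤ (k + 1) * (h * M) := by
      intro k
      induction k with
      | zero =>
        have h1 := abs_le.1 (hstepM j)
        have h2 : v (j + 1) ≤ 0 := hi1
        have h3 : 0 ≤ v j := hi2
        simp only [Nat.cast_zero, add_zero, zero_add, one_mul]
        rw [abs_le]
        constructor <;> linarith
      | succ k ih =>
        have h1 := hstepM (j + 1 + k)
        have h2 := abs_sub_abs_le_abs_sub (v (j + 1 + k + 1)) (v (j + 1 + k))
        push_cast
        rw [← add_assoc]
        linarith
    intro i
    have h1 := key (i - (j + 1)).val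
    rw [ZMod.natCast_zmod_val, add_sub_cancel] at h1
    refine h1.trans ?_
    have h2 : (((i - (j + 1)).val : ℝ) + 1) ≤ N := by
      exact_mod_cast ZMod.val_lt (i - (j + 1))
    calc _ ≤ (N : ℝ) * (h * M) := by gcongr
      _ = B := by rw [← mul_assoc, hNh]
  have hustep : ∀ i, u (i + 1) = u i + h * Real.sin (Real.arctan (v i)) := by
    intro i
    have h1 : Real.sin (Real.arctan (v i)) = (u (i + 1) - u i) / h :=
      sin_arctan_truncTanArcsin hB0 (hvB i)
    rw [h1]
    field_simp
    ring
  refine ⟨fun k => (u k, v k), by simp, ?_, fun k hk => ?_⟩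
  · rw [Prod.norm_def]
    exact max_le_max (hua _) (hvB _)
  · have hFτ : ∀ x y, F (τ ((k : ZMod N) + 1)) x y = F (((k + 1 : ℕ) : ℝ) * h) x y := by
      intro x y
      rcases Nat.lt_or_ge (k + 1) N with hlt | hge
      · have : τ ((k : ZMod N) + 1) = ((k + 1 : ℕ) : ℝ) * h := by
          simp only [hτ]
          rw [← Nat.cast_succ, ZMod.val_natCast_of_lt hlt]
        rw [this]
      · have hk1 : k + 1 = N := by omega
        have : τ ((k : ZMod N) + 1) = 0 := by
          simp only [hτ]
          rw [← Nat.cast_succ, Nat.succ_eq_add_one, hk1]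
          simp
        rw [this, hk1, hNh, ← hper 0, zero_add]
    set x : ℝ × ℝ := (u k, v k) with hx
    set y : ℝ × ℝ := (u ((k + 1 : ℕ) : ZMod N), v ((k + 1 : ℕ) : ZMod N)) with hy
    have hcast : ((k + 1 : ℕ) : ZMod N) = (k : ZMod N) + 1 := by push_cast; rfl
    have hy1 : y.1 - x.1 = h * Real.sin (Real.arctan x.2) := by
      simp only [hx, hy, hcast, hustep]; ring
    have hy2 : y.2 - x.2 = h * F (((k + 1 : ℕ) : ℝ) * h) y.1 y.2 := by
      rw [← hFτ]
      simp only [hx, hy, hcast]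
      linarith [hstep k]
    have ht0 := htime k hk.le
    have ht1 := htime (k + 1) hk
    have hyx : ‖y - x‖ ≤ h * M := by
      rw [Prod.norm_def]
      refine max_le ?_ ?_
      · rw [Prod.fst_sub, hy1, norm_mul, Real.norm_eq_abs, abs_of_pos hhpos]
        gcongr
        exact hχM _
      · rw [Prod.snd_sub, hy2, norm_mul, Real.norm_eq_abs, abs_of_pos hhpos]
        gcongr
        exact hFM _ ht1 _ _
    have hC : 0 ≤ L * (1 + M) * h ^ 2 := by positivity
    change ‖y - x - h • phaseField F (k * h) x‖ ≤ _
    rw [Prod.norm_def]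
    refine max_le ?_ ?_
    · change ‖y.1 - x.1 - h * Real.sin (Real.arctan x.2)‖ ≤ _
      rwa [hy1, sub_self, norm_zero]
    · change ‖y.2 - x.2 - h * F (k * h) x.1 x.2‖ ≤ _
      rw [hy2, ← mul_sub, norm_mul, Real.norm_eq_abs, abs_of_pos hhpos]
      have h1 := hFL _ ht1 _ ht0 y x
      have h2 : |((k + 1 : ℕ) : ℝ) * h - k * h| = h := by
        rw [← abs_of_pos hhpos]
        push_cast
        ring_nf
        simp
      rw [h2] at h1
      calc h * ‖_‖ ≤ h * (L * (h + h * M)) := by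
            refine mul_le_mul_of_nonneg_left (h1.trans ?_) hhpos.le
            gcongr
        _ = _ := by ring

end Scheme

section Pendulum

variable {T : ℝ}

theorem exists_periodic_phase_orbit {F : ℝ → ℝ → ℝ → ℝ} {L M a : ℝ} (hT : 0 < T) (hL0 : 0 ≤ L)
    (hM0 : 0 ≤ M) (ha : 0 ≤ a) (hper : ∀ t u v, F (t + T) u v = F t u v)
    (hL : ∀ t ∈ Icc (-T) (2 * T), ∀ s ∈ Icc (-T) (2 * T), ∀ x y,
      ‖phaseField F t x - phaseField F s y‖ ≤ L * (|t - s| + ‖x - y‖))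
    (hM : ∀ t ∈ Icc (-T) (2 * T), ∀ x, ‖phaseField F t x‖ ≤ M)
    (hlow : ∀ t ∈ Icc 0 T, F t (-a) 0 ≤ 0) (hhigh : ∀ t ∈ Icc 0 T, 0 < F t a 0) :
    ∃ W : ℝ → ℝ × ℝ, (∀ t, W (t + T) = W t) ∧ ∀ t, HasDerivAt W (phaseField F t (W t)) t := by
  refine exists_periodic_solution_of_discrete (R := max a (T * M)) hT hL0 hM0
    (fun t x => by simp [phaseField, hper]) hL hM (C := L * (1 + M)) (by positivity) ?_
  have hlim : Tendsto (fun N : ℕ => T / (N : ℝ) * L) atTop (𝓝 (0 * L)) :=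
    (tendsto_const_div_atTop_nhds_zero_nat T).mul_const L
  rw [zero_mul] at hlim
  filter_upwards [hlim.eventually_le_const one_pos, eventually_ne_atTop 0] with N hN hN0
  have : NeZero N := ⟨hN0⟩
  exact exists_discrete_periodic_orbit hT hL0 hM0 ha hper hL hM hlow hhigh hN

theorem lt_of_periodic_of_deriv_deriv_pos (hT : 0 < T) {w : ℝ → ℝ} (hw : Differentiable ℝ w)
    (hper : ∀ t, w (t + T) = w t) {c : ℝ}
    (hpos : ∀ t, c ≤ w t → deriv w t = 0 → 0 < deriv (deriv w) t) (t : ℝ) : w t < c := by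
  by_contra! hc
  obtain ⟨s, -, hs⟩ := (isCompact_Icc (a := (0 : ℝ)) (b := T)).exists_isMaxOn
    ⟨0, le_rfl, hT.le⟩ hw.continuous.continuousOn
  have hmax : ∀ r, w r ≤ w s := by
    intro r
    obtain ⟨y, hy, hyr⟩ := Function.Periodic.exists_mem_Ico₀ (f := w) hper hT r
    rw [hyr]
    exact hs ⟨hy.1, hy.2.le⟩
  have hlmax : IsLocalMax w s := Eventually.of_forall hmax
  have hd : deriv w s = 0 := hlmax.deriv_eq_zero
  have hdd := hpos s (hc.trans (hmax t)) hd
  have hlmin := isLocalMin_of_deriv_deriv_pos hdd hd hw.continuous.continuousAt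
  have hconst : w =ᶠ[𝓝 s] fun _ => w s := by
    filter_upwards [hlmin] with r hr using le_antisymm (hmax r) hr
  have := hconst.deriv.deriv_eq
  simp at this
  linarith

theorem hasDerivAt_sin_arctan (v : ℝ) :
    HasDerivAt (fun v => Real.sin (Real.arctan v))
      (Real.cos (Real.arctan v) * (1 / (1 + v ^ 2))) v :=
  (Real.hasDerivAt_sin _).comp v (Real.hasDerivAt_arctan v)

theorem abs_sin_arctan_sub_le (x y : ℝ) :
    |Real.sin (Real.arctan x) - Real.sin (Real.arctan y)| ≤ |x - y| := by
  have := convex_univ.norm_image_sub_le_of_norm_hasDerivWithin_le (C := 1)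
    (fun v _ => (hasDerivAt_sin_arctan v).hasDerivWithinAt)
    (fun v _ => by
      rw [norm_mul, Real.norm_eq_abs, Real.norm_eq_abs]
      refine mul_le_one₀ (Real.abs_cos_le_one _) (abs_nonneg _) ?_
      rw [abs_of_pos (by positivity), div_le_one (by positivity)]
      nlinarith [sq_nonneg v]) (mem_univ y) (mem_univ x)
  simpa using this

theorem abs_sin_arctan_lt_one (v : ℝ) : |Real.sin (Real.arctan v)| < 1 := by
  rw [← sq_lt_one_iff_abs_lt_one]
  have h1 := Real.sin_sq_add_cos_sq (Real.arctan v)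
  have h2 := pow_pos (Real.cos_arctan_pos v) 2
  linarith

theorem sin_arctan_div_sqrt (v : ℝ) :
    Real.sin (Real.arctan v) / Real.sqrt (1 - Real.sin (Real.arctan v) ^ 2) = v := by
  rw [← Real.cos_sq', Real.sqrt_sq (Real.cos_arctan_pos v).le, ← Real.tan_eq_sin_div_cos,
    Real.tan_arctan]

/-- Truncating the position variable to `[-a, a]` turns a `C¹` right-hand side into a bounded
Lipschitz phase field. -/
theorem exists_lipschitz_bound_phaseField {g : ℝ × ℝ × ℝ → ℝ} (hg : ContDiff ℝ 1 g) {a : ℝ}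
    (ha : 0 ≤ a) {b c : ℝ} :
    ∃ L M : ℝ, 0 ≤ L ∧ 0 ≤ M ∧
      (∀ t ∈ Icc b c, ∀ s ∈ Icc b c, ∀ x y,
        ‖phaseField (fun t u v => g (t, max (-a) (min a u), Real.sin (Real.arctan v))) t x -
          phaseField (fun t u v => g (t, max (-a) (min a u), Real.sin (Real.arctan v))) s y‖
          ≤ L * (|t - s| + ‖x - y‖)) ∧
      ∀ t ∈ Icc b c, ∀ x,
        ‖phaseField (fun t u v => g (t, max (-a) (min a u), Real.sin (Real.arctan v))) t x‖
          ≤ M := by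
  set K : Set (ℝ × ℝ × ℝ) := Icc b c ×ˢ Icc (-a) a ×ˢ Icc (-1) 1 with hK
  have hKc : IsCompact K := isCompact_Icc.prod (isCompact_Icc.prod isCompact_Icc)
  have hKconv : Convex ℝ K := (convex_Icc _ _).prod ((convex_Icc _ _).prod (convex_Icc _ _))
  obtain ⟨L, hL⟩ := hg.contDiffOn.exists_lipschitzOnWith one_ne_zero hKconv hKc
  obtain ⟨M, hM⟩ := hKc.exists_bound_of_continuousOn hg.continuous.continuousOn
  have hmem : ∀ t ∈ Icc b c, ∀ u v : ℝ,
      (t, max (-a) (min a u), Real.sin (Real.arctan v)) ∈ K := fun t ht u v =>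
    ⟨ht, ⟨le_max_left _ _, max_le (by linarith) (min_le_left _ _)⟩,
      Real.neg_one_le_sin _, Real.sin_le_one _⟩
  have hclamp : ∀ u w : ℝ, |max (-a) (min a u) - max (-a) (min a w)| ≤ |u - w| := by
    intro u w
    refine (abs_max_sub_max_le_max _ _ _ _).trans (max_le (by simp) ?_)
    exact (abs_min_sub_min_le_max _ _ _ _).trans (max_le (by simp) le_rfl)
  refine ⟨L + 1, max M 1, by positivity, by positivity, fun t ht s hs x y => ?_,
    fun t ht x => ?_⟩
  · have hx1 : |x.1 - y.1| ≤ ‖x - y‖ := norm_fst_le (x - y)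
    have hx2 : |x.2 - y.2| ≤ ‖x - y‖ := norm_snd_le (x - y)
    have hsum : 0 ≤ |t - s| + ‖x - y‖ := by positivity
    have hχ := abs_sin_arctan_sub_le x.2 y.2
    refine max_le ?_ ?_
    · change |Real.sin (Real.arctan x.2) - Real.sin (Real.arctan y.2)| ≤ _
      have : 0 ≤ (L : ℝ) * (|t - s| + ‖x - y‖) := by positivity
      linarith [abs_nonneg (t - s)]
    · have h1 := hL.dist_le_mul _ (hmem t ht x.1 x.2) _ (hmem s hs y.1 y.2)
      rw [Real.dist_eq] at h1
      have h2 : dist (t, max (-a) (min a x.1), Real.sin (Real.arctan x.2))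
          (s, max (-a) (min a y.1), Real.sin (Real.arctan y.2)) ≤ |t - s| + ‖x - y‖ := by
        rw [Prod.dist_eq, Prod.dist_eq, Real.dist_eq, Real.dist_eq, Real.dist_eq]
        refine max_le (by linarith [norm_nonneg (x - y)]) (max_le ?_ ?_)
        · linarith [abs_nonneg (t - s), hclamp x.1 y.1]
        · linarith [abs_nonneg (t - s)]
      refine h1.trans ?_
      gcongr
      linarith
  · refine max_le ?_ ?_
    · exact (Real.abs_sin_le_one _).trans (le_max_right _ _)
    · exact (hM _ (hmem t ht x.1 x.2)).trans (le_max_left _ _)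

/-- Well-ordered constant lower and upper solutions `-a` and `a` of `(u' / √(1 - u'²))' = g` enclose
a periodic solution. -/
theorem exists_periodic_solution_between {g : ℝ × ℝ × ℝ → ℝ} (hg : ContDiff ℝ 1 g) (hT : 0 < T)
    {a : ℝ} (ha : 0 ≤ a) (hper : ∀ t u p, g (t + T, u, p) = g (t, u, p))
    (hlow : ∀ t ∈ Icc 0 T, g (t, -a, 0) < 0) (hhigh : ∀ t ∈ Icc 0 T, 0 < g (t, a, 0)) :
    ∃ φ : ℝ → ℝ, ContDiff ℝ 2 φ ∧ (∀ t, φ (t + T) = φ t) ∧ (∀ t, |deriv φ t| < 1) ∧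
      (∀ t, HasDerivAt (fun s => deriv φ s / Real.sqrt (1 - (deriv φ s) ^ 2))
        (g (t, φ t, deriv φ t)) t) ∧
      (∀ t, -a < φ t ∧ φ t < a) := by
  have hmod : ∀ t, ∃ s ∈ Icc 0 T, ∀ u p, g (t, u, p) = g (s, u, p) := by
    intro t
    have hp : Function.Periodic (fun t u p => g (t, u, p)) T := fun t => by
      funext u p
      exact hper t u p
    obtain ⟨s, hs, heq⟩ := hp.exists_mem_Ico₀ hT t
    exact ⟨s, ⟨hs.1, hs.2.le⟩, fun u p => congrFun (congrFun heq u) p⟩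
  set F : ℝ → ℝ → ℝ → ℝ :=
    fun t u v => g (t, max (-a) (min a u), Real.sin (Real.arctan v)) with hF
  obtain ⟨L, M, hL0, hM0, hL, hM⟩ := exists_lipschitz_bound_phaseField hg ha (b := -T) (c := 2 * T)
  obtain ⟨W, hWper, hW⟩ := exists_periodic_phase_orbit (F := F) hT hL0 hM0 ha
    (fun t u v => hper t _ _) hL hM
    (fun t ht => by simpa [hF, ha] using (hlow t ht).le)
    (fun t ht => by simpa [hF, ha] using hhigh t ht)
  set φ : ℝ → ℝ := fun t => (W t).1 with hφ
  set v : ℝ → ℝ := fun t => (W t).2 with hv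
  have hφd : ∀ t, HasDerivAt φ (Real.sin (Real.arctan (v t))) t := fun t => (hW t).fst
  have hvd : ∀ t, HasDerivAt v (F t (φ t) (v t)) t := fun t => (hW t).snd
  have hderiv : deriv φ = fun t => Real.sin (Real.arctan (v t)) := funext fun t => (hφd t).deriv
  have hφdiff : Differentiable ℝ φ := fun t => (hφd t).differentiableAt
  have hφper : ∀ t, φ (t + T) = φ t := fun t => by simp only [hφ, hWper]
  have hdd : ∀ t, deriv φ t = 0 →
      deriv (deriv φ) t = g (t, max (-a) (min a (φ t)), 0) := by
    intro t ht
    have hv0 : v t = 0 := by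
      rw [← sin_arctan_div_sqrt (v t), ← congrFun hderiv t, ht]
      simp
    rw [hderiv]
    have := ((hasDerivAt_sin_arctan (v t)).comp t (hvd t)).deriv
    simp only [Function.comp_def] at this
    rw [this, hv0]
    simp [hF]
  have hup : ∀ t, φ t < a := by
    refine lt_of_periodic_of_deriv_deriv_pos hT hφdiff hφper fun t ht hd => ?_
    obtain ⟨s, hs, heq⟩ := hmod t
    rw [hdd t hd, heq, min_eq_left ht, max_eq_right (by linarith)]
    exact hhigh s hs
  have hdown : ∀ t, -φ t < a := by
    refine lt_of_periodic_of_deriv_deriv_pos hT hφdiff.neg (fun t => by simp [hφper])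
      fun t ht hd => ?_
    have hneg : deriv (fun t => -φ t) = fun t => -deriv φ t := funext fun t => deriv.fun_neg
    obtain ⟨s, hs, heq⟩ := hmod t
    change a ≤ -φ t at ht
    change deriv (fun t => -φ t) t = 0 at hd
    change 0 < deriv (deriv (fun t => -φ t)) t
    rw [hneg] at hd ⊢
    rw [deriv.fun_neg, hdd t (neg_eq_zero.1 hd), heq, max_eq_left]
    · linarith [hlow s hs]
    · exact (min_le_right _ _).trans (by linarith)
  have hvd' : ∀ t, HasDerivAt v (g (t, φ t, Real.sin (Real.arctan (v t)))) t := by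
    intro t
    have := hvd t
    simp only [hF] at this
    rwa [min_eq_right (hup t).le, max_eq_right (by linarith [hdown t])] at this
  have hvdiff : Differentiable ℝ v := fun t => (hvd' t).differentiableAt
  have hvC : ContDiff ℝ 1 v := by
    rw [contDiff_one_iff_deriv]
    refine ⟨hvdiff, ?_⟩
    rw [funext fun t => (hvd' t).deriv]
    exact hg.continuous.comp (continuous_id.prodMk (hφdiff.continuous.prodMk
      (Real.continuous_sin.comp (Real.continuous_arctan.comp hvdiff.continuous))))
  refine ⟨φ, ?_, hφper, fun t => ?_, fun t => ?_, fun t => ⟨by linarith [hdown t], hup t⟩⟩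
  · rw [show (2 : WithTop ℕ∞) = 1 + 1 by norm_num, contDiff_succ_iff_deriv]
    refine ⟨hφdiff, by simp, ?_⟩
    rw [hderiv]
    exact Real.contDiff_sin.comp (Real.contDiff_arctan.comp hvC)
  · rw [hderiv]
    exact abs_sin_arctan_lt_one _
  · simp only [hderiv, sin_arctan_div_sqrt]
    exact hvd' t

end Pendulum

end


/-- The forced relativistic pendulum with viscous friction
`d/dt (φ̇ / √(1 - φ̇²)) = f(t, φ, φ̇) - γ φ̇ + α sin φ`, with `f` `T`-periodic in `t` and
`2π`-periodic in `φ`, satisfying `f(t, -π/2, 0) < α` and `f(t, π/2, 0) > -α` on `[0,T]`,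
has a `T`-periodic solution `φ` with `-π/2 < φ(t) < π/2` for all `t`. -/
theorem stmt_2 (T α γ : ℝ) (hT : 0 < T) (hα : 0 < α) (f : ℝ → ℝ → ℝ → ℝ)
    (hf : ContDiff ℝ 1 (fun x : ℝ × ℝ × ℝ => f x.1 x.2.1 x.2.2))
    (hf_per_t : ∀ t φ p, f (t + T) φ p = f t φ p)
    (hf_per_φ : ∀ t φ p, f t (φ + 2 * Real.pi) p = f t φ p)
    (hlow : ∀ t ∈ Set.Icc (0 : ℝ) T, f t (-(Real.pi / 2)) 0 < α)
    (hhigh : ∀ t ∈ Set.Icc (0 : ℝ) T, f t (Real.pi / 2) 0 > -α) :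
    ∃ φ : ℝ → ℝ, ContDiff ℝ 2 φ ∧ (∀ t, φ (t + T) = φ t) ∧ (∀ t, |deriv φ t| < 1) ∧
      (∀ t, HasDerivAt (fun s => deriv φ s / Real.sqrt (1 - (deriv φ s) ^ 2))
        (f t (φ t) (deriv φ t) - γ * deriv φ t + α * Real.sin (φ t)) t) ∧
      (∀ t, -(Real.pi / 2) < φ t ∧ φ t < Real.pi / 2) := by
  have hπ := Real.pi_pos
  refine exists_periodic_solution_between
    (g := fun x => f x.1 x.2.1 x.2.2 - γ * x.2.2 + α * Real.sin x.2.1) (a := Real.pi / 2)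
    ?_ hT (by positivity) (fun t u p => ?_) (fun t ht => ?_) (fun t ht => ?_)
  · exact (hf.sub (contDiff_const.mul contDiff_snd.snd)).add
      (contDiff_const.mul (Real.contDiff_sin.comp contDiff_snd.fst))
  · simp only [hf_per_t]
  · simpa using hlow t ht
  · have := hhigh t ht
    simp only [mul_zero, sub_zero, Real.sin_pi_div_two, mul_one]
    linarith
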